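/- arXiv:1707.09150 — 8 statements merged into one kernel-verified Lean document; each statement's English description precedes it below -/
import Mathlib

section
/- Let n ≥ 2 and d = n(n+1)/2 − 1. Let B_1, …, B_d be any basis of the d-dimensional real vector space of n×n real symmetric matrices with trace zero, and for a real symmetric n×n matrix X let 𝓑(X) denote the d×d symmetric matrix whose (i,j) entry is tr(B_i X B_j). Then a real symmetric n×n matrix X belongs to S^{n,1} if and only if 𝓑(X) is positive semidefinite. -/
open Matrix Finset

/-- `Ek n k X` is the coefficient of `t ^ (n - k)` in `det (t • 1 + X)`, i.e. the elementary
symmetric polynomial of degree `k` evaluated at the eigenvalues of `X`. -/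
noncomputable def Ek (n k : ℕ) (X : Matrix (Fin n) (Fin n) ℝ) : ℝ :=
  (Matrix.charpoly (-X)).coeff (n - k)

lemma esum_zero_iff {n : ℕ} (m : Fin n → ℝ) :
    ∑ i, ∏ j ∈ univ.erase i, m j = 0 ↔
      n = 0 ∨ ∃ a : Fin n → ℝ, a ≠ 0 ∧ ∃ c : ℝ, ∑ i, a i = 0 ∧ ∀ i, m i * a i = c := by
  rcases Nat.eq_zero_or_pos n with h0 | hpos
  · subst h0; simp
  have hn0 : n ≠ 0 := by omega
  simp only [hn0, false_or]
  have hnz : (∀ i, m i ≠ 0) → ∑ i, ∏ j ∈ univ.erase i, m j = (∏ j, m j) * ∑ i, (m i)⁻¹ := by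
    intro h
    rw [Finset.mul_sum]
    refine Finset.sum_congr rfl fun i _ => ?_
    rw [← Finset.mul_prod_erase univ m (Finset.mem_univ i)]
    field_simp [h i]
  have hz : ∀ k, m k = 0 → ∑ i, ∏ j ∈ univ.erase i, m j = ∏ j ∈ univ.erase k, m j := by
    intro k hk
    refine Finset.sum_eq_single k (fun i _ hi => ?_) (by simp)
    exact Finset.prod_eq_zero (Finset.mem_erase.2 ⟨Ne.symm hi, Finset.mem_univ k⟩) hk
  constructor
  · intro h
    by_cases hall : ∀ i, m i ≠ 0
    · rw [hnz hall] at h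
      have hp : ∏ j, m j ≠ 0 := Finset.prod_ne_zero_iff.2 fun i _ => hall i
      refine ⟨fun i => (m i)⁻¹, ?_, 1, (mul_eq_zero.1 h).resolve_left hp,
        fun i => mul_inv_cancel₀ (hall i)⟩
      intro hh
      have := congrFun hh ⟨0, hpos⟩
      exact hall _ (inv_eq_zero.1 this)
    · push Not at hall
      obtain ⟨k, hk⟩ := hall
      rw [hz k hk] at h
      obtain ⟨l, hl, hml⟩ := Finset.prod_eq_zero_iff.1 h
      have hlk : l ≠ k := (Finset.mem_erase.1 hl).1
      refine ⟨Pi.single k 1 - Pi.single l 1, ?_, 0, ?_, ?_⟩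
      · intro hh
        have := congrFun hh k
        simp [Pi.single_apply, hlk.symm] at this
      · simp
      · intro i
        by_cases h1 : i = k
        · subst h1; simp [hk]
        · by_cases h2 : i = l
          · subst h2; simp [hml]
          · simp [Pi.single_apply, h1, h2]
  · rintro ⟨a, ha, c, hs, hc⟩
    obtain ⟨k, hk⟩ := Function.ne_iff.1 ha
    by_cases hc0 : c = 0
    · subst hc0
      have hmk : m k = 0 := (mul_eq_zero.1 (hc k)).resolve_right hk
      rw [hz k hmk]
      have : ∃ l ∈ univ.erase k, a l ≠ 0 := by
        by_contra hcon
        push Not at hcon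
        rw [← Finset.add_sum_erase univ a (Finset.mem_univ k), Finset.sum_eq_zero hcon] at hs
        exact hk (by simpa using hs)
      obtain ⟨l, hl, hal⟩ := this
      exact Finset.prod_eq_zero hl ((mul_eq_zero.1 (hc l)).resolve_right hal)
    · have hall : ∀ i, m i ≠ 0 := by
        intro i hi
        have := hc i
        rw [hi, zero_mul] at this
        exact hc0 this.symm
      rw [hnz hall]
      have : c * ∑ i, (m i)⁻¹ = 0 := by
        rw [← hs, Finset.mul_sum]
        refine Finset.sum_congr rfl fun i _ => ?_
        rw [← hc i]
        field_simp [hall i]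
      rw [(mul_eq_zero.1 this).resolve_left hc0, mul_zero]

lemma scalar_main {n : ℕ} (hn : 2 ≤ n) (l : Fin n → ℝ) :
    (∀ t : ℝ, ∑ i, ∏ j ∈ univ.erase i, (l j - t) = 0 → 0 ≤ t) ↔
      ∀ a : Fin n → ℝ, ∑ i, a i = 0 → 0 ≤ ∑ i, l i * a i ^ 2 := by
  have hn0 : n ≠ 0 := by omega
  have hnR : (n : ℝ) ≠ 0 := by exact_mod_cast hn0
  simp only [esum_zero_iff (n := n), hn0, false_or]
  constructor
  · intro H
    let P : Matrix (Fin n) (Fin n) ℝ := 1 - Matrix.of fun _ _ => (n : ℝ)⁻¹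
    have hP : ∀ v i, (P *ᵥ v) i = v i - (∑ j, v j) / n := by
      intro v i
      simp only [P, Matrix.sub_mulVec, Matrix.one_mulVec, Pi.sub_apply]
      simp only [Matrix.mulVec, dotProduct, Matrix.of_apply, ← Finset.mul_sum]
      ring
    have hPs : ∀ v, ∑ i, (P *ᵥ v) i = 0 := by
      intro v
      simp only [hP, Finset.sum_sub_distrib, Finset.sum_const, Finset.card_univ, Fintype.card_fin,
        nsmul_eq_mul]
      field_simp
      ring
    have hPH : Pᴴ = P := by
      ext i j
      simp [P, Matrix.one_apply, eq_comm]
    have hM : (Pᴴ * diagonal l * P).IsHermitian :=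
      isHermitian_conjTranspose_mul_mul P (by simp [Matrix.IsHermitian])
    have hpsd : (Pᴴ * diagonal l * P).PosSemidef := by
      rw [hM.posSemidef_iff_eigenvalues_nonneg]
      intro k
      show 0 ≤ hM.eigenvalues k
      by_contra hneg
      push Not at hneg
      refine absurd (H (hM.eigenvalues k) ?_) (not_le.2 hneg)
      have hev := hM.mulVec_eigenvectorBasis k
      have hv0 : (⇑(hM.eigenvectorBasis k) : Fin n → ℝ) ≠ 0 := by
        have := hM.eigenvectorBasis.orthonormal.ne_zero k
        intro hh
        apply this
        ext i
        exact congrFun hh i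
      generalize hv : (⇑(hM.eigenvectorBasis k) : Fin n → ℝ) = v at hev hv0
      generalize hM.eigenvalues k = τ at hev hneg
      rw [hPH, ← Matrix.mulVec_mulVec, ← Matrix.mulVec_mulVec] at hev
      have hsum : ∑ i, v i = 0 := by
        have h1 := hPs (diagonal l *ᵥ P *ᵥ v)
        rw [hev] at h1
        simp only [Pi.smul_apply, smul_eq_mul, ← Finset.mul_sum] at h1
        exact (mul_eq_zero.1 h1).resolve_left hneg.ne
      have hPv : P *ᵥ v = v := by
        ext i; rw [hP, hsum]; simp
      rw [hPv] at hev
      refine ⟨v, hv0, (∑ j, l j * v j) / n, hsum, fun i => ?_⟩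
      have h2 := congrFun hev i
      rw [hP] at h2
      simp only [Matrix.mulVec_diagonal, Pi.smul_apply, smul_eq_mul] at h2
      linarith
    intro a ha
    have h3 := hpsd.dotProduct_mulVec_nonneg a
    have hPa : P *ᵥ a = a := by
      ext i; rw [hP, ha]; simp
    rw [← Matrix.mulVec_mulVec, ← Matrix.mulVec_mulVec, hPa, dotProduct_mulVec,
      ← Matrix.star_mulVec, hPa] at h3
    simp only [dotProduct, Matrix.mulVec_diagonal, Pi.star_apply, star_trivial] at h3
    refine h3.trans_eq (Finset.sum_congr rfl fun i _ => by ring)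
  · rintro H t ⟨a, ha, c, hs, hc⟩
    by_contra ht
    push Not at ht
    have h1 := H a hs
    have h2 : ∑ i, (l i - t) * a i ^ 2 = 0 := by
      have : ∀ i, (l i - t) * a i ^ 2 = c * a i := fun i => by rw [← hc i]; ring
      simp only [this, ← Finset.mul_sum, hs, mul_zero]
    have h3 : ∑ i, l i * a i ^ 2 = t * ∑ i, a i ^ 2 := by
      simp only [sub_mul, Finset.sum_sub_distrib, ← Finset.mul_sum] at h2
      linarith
    obtain ⟨k, hk⟩ := Function.ne_iff.1 ha
    have h4 : 0 < ∑ i, a i ^ 2 :=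
      Finset.sum_pos' (fun i _ => sq_nonneg _) ⟨k, Finset.mem_univ k, by
        have : a k ≠ 0 := hk
        positivity⟩
    nlinarith

lemma Ek_eq {n : ℕ} (hn : 2 ≤ n) (U X : Matrix (Fin n) (Fin n) ℝ) (l : Fin n → ℝ)
    (hU : Uᵀ * U = 1) (hU' : U * Uᵀ = 1) (hX : X = U * diagonal l * Uᵀ) (t : ℝ) :
    Ek n (n - 1) (X - t • 1) = ∑ i, ∏ j ∈ univ.erase i, (l j - t) := by
  have h1 : -(X - t • 1) = U * (diagonal (fun i => t - l i) * Uᵀ) := by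
    have : diagonal (fun i => t - l i) = t • 1 - diagonal l := by
      ext i j
      by_cases h : i = j
      · subst h; simp
      · simp [h]
    rw [this, hX, Matrix.sub_mul, Matrix.mul_sub, Matrix.smul_mul, Matrix.one_mul,
      Matrix.mul_smul, hU', neg_sub, Matrix.mul_assoc]
  have h2 : n - (n - 1) = 0 + 1 := by omega
  have h3 := Polynomial.coeff_derivative (∏ i, (Polynomial.X - Polynomial.C (t - l i))) 0
  rw [Ek, h1, Matrix.charpoly_mul_comm, Matrix.mul_assoc, hU, Matrix.mul_one,
    Matrix.charpoly_diagonal, h2]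
  simp only [Nat.cast_zero, zero_add, mul_one] at h3 ⊢
  rw [← h3, Polynomial.coeff_zero_eq_eval_zero, Polynomial.derivative_prod_finset]
  simp [Polynomial.eval_finsetSum, Polynomial.eval_prod]

lemma diag_main {n : ℕ} (l : Fin n → ℝ) :
    (∀ a : Fin n → ℝ, ∑ i, a i = 0 → 0 ≤ ∑ i, l i * a i ^ 2) ↔
    ∀ A : Matrix (Fin n) (Fin n) ℝ, A.IsHermitian → A.trace = 0 →
      0 ≤ (A * diagonal l * A).trace := by
  constructor
  · intro H A hA hT
    have hs : ∀ i j, A i j = A j i := fun i j => by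
      have := hA.apply j i
      simpa using this
    have hpair : ∀ i j, i ≠ j → 0 ≤ l i + l j := by
      intro i j hij
      have := H (Pi.single i 1 - Pi.single j 1) (by simp)
      rw [Fintype.sum_eq_add i j hij] at this
      · simpa [Pi.single_apply, hij, hij.symm] using this
      · rintro x ⟨h1, h2⟩
        simp [Pi.single_apply, h1, h2]
    have e1 : (A * diagonal l * A).trace = ∑ i, ∑ j, l j * A i j ^ 2 := by
      simp only [Matrix.trace, Matrix.diag_apply, Matrix.mul_apply (M := A * diagonal l),
        Matrix.mul_diagonal]
      refine Finset.sum_congr rfl fun i _ => Finset.sum_congr rfl fun j _ => ?_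
      rw [hs j i]; ring
    have e2 : ∑ i, ∑ j, l j * A i j ^ 2 = ∑ i, ∑ j, l i * A i j ^ 2 := by
      rw [Finset.sum_comm]
      refine Finset.sum_congr rfl fun i _ => Finset.sum_congr rfl fun j _ => ?_
      rw [hs j i]
    have e3 : ∑ i, ∑ j, l j * A i j ^ 2 + ∑ i, ∑ j, l i * A i j ^ 2 ≥
        ∑ i, 2 * (l i * A i i ^ 2) := by
      rw [← Finset.sum_add_distrib]
      refine Finset.sum_le_sum fun i _ => ?_
      rw [← Finset.sum_add_distrib, ← Finset.add_sum_erase univ _ (Finset.mem_univ i)]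
      have : 0 ≤ ∑ j ∈ univ.erase i, (l j * A i j ^ 2 + l i * A i j ^ 2) := by
        refine Finset.sum_nonneg fun j hj => ?_
        rw [← add_mul]
        exact mul_nonneg (hpair j i (Finset.mem_erase.1 hj).1) (sq_nonneg _)
      linarith
    have e4 := H (fun i => A i i) hT
    rw [← Finset.mul_sum] at e3
    rw [e1]
    linarith
  · intro H a ha
    have := H (diagonal a) (by simp [Matrix.IsHermitian]) (by simpa using ha)
    simp only [Matrix.diagonal_mul_diagonal, Matrix.trace_diagonal] at this
    exact this.trans_eq (Finset.sum_congr rfl fun i _ => by ring)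

lemma conj_main {n : ℕ} (U X : Matrix (Fin n) (Fin n) ℝ) (l : Fin n → ℝ)
    (hU : Uᵀ * U = 1) (hU' : U * Uᵀ = 1) (hX : X = U * diagonal l * Uᵀ) :
    (∀ A : Matrix (Fin n) (Fin n) ℝ, A.IsHermitian → A.trace = 0 →
      0 ≤ (A * diagonal l * A).trace) ↔
    ∀ A : Matrix (Fin n) (Fin n) ℝ, A.IsHermitian → A.trace = 0 →
      0 ≤ (A * X * A).trace := by
  have hUs : Uᴴ = Uᵀ := by ext; simp
  have key : ∀ A : Matrix (Fin n) (Fin n) ℝ,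
      ((Uᵀ * A * U) * diagonal l * (Uᵀ * A * U)).trace = (A * X * A).trace := by
    intro A
    have : (Uᵀ * A * U) * diagonal l * (Uᵀ * A * U) = Uᵀ * (A * X * A * U) := by
      rw [hX]; simp only [Matrix.mul_assoc]
    rw [this, Matrix.trace_mul_comm, Matrix.mul_assoc, hU', Matrix.mul_one]
  constructor
  · intro H A hA hT
    rw [← key]
    refine H _ ?_ ?_
    · rw [← hUs]; exact isHermitian_conjTranspose_mul_mul U hA
    · rw [Matrix.mul_assoc, Matrix.trace_mul_comm, Matrix.mul_assoc, hU', Matrix.mul_one, hT]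
  · intro H A hA hT
    have h := H (U * A * Uᵀ) (by rw [← hUs]; exact isHermitian_mul_mul_conjTranspose U hA)
      (by rw [Matrix.mul_assoc, Matrix.trace_mul_comm, Matrix.mul_assoc, hU, Matrix.mul_one, hT])
    rw [← key] at h
    have : Uᵀ * (U * A * Uᵀ) * U = A := by
      calc Uᵀ * (U * A * Uᵀ) * U = (Uᵀ * U) * A * (Uᵀ * U) := by simp only [Matrix.mul_assoc]
        _ = A := by rw [hU, Matrix.one_mul, Matrix.mul_one]
    rwa [this] at h

theorem stmt0 {n : ℕ} (hn : 2 ≤ n) (d : ℕ) (hd : d = n * (n + 1) / 2 - 1)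
    (B : Fin d → Matrix (Fin n) (Fin n) ℝ)
    (hBsym : ∀ i, (B i).IsHermitian)
    (hBtr : ∀ i, (B i).trace = 0)
    (hBli : LinearIndependent ℝ B)
    (hBspan : ∀ A : Matrix (Fin n) (Fin n) ℝ, A.IsHermitian → A.trace = 0 →
      A ∈ Submodule.span ℝ (Set.range B))
    (X : Matrix (Fin n) (Fin n) ℝ) (hX : X.IsHermitian) :
    (∀ t : ℝ, Ek n (n - 1) (X - t • 1) = 0 → 0 ≤ t) ↔
      (Matrix.of fun i j => (B i * X * B j).trace : Matrix (Fin d) (Fin d) ℝ).PosSemidef := by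
  obtain ⟨U, l, hU, hU', hXe⟩ : ∃ (U : Matrix (Fin n) (Fin n) ℝ) (l : Fin n → ℝ),
      Uᵀ * U = 1 ∧ U * Uᵀ = 1 ∧ X = U * diagonal l * Uᵀ := by
    have hs : ∀ V : Matrix (Fin n) (Fin n) ℝ, star V = Vᵀ := fun V => by ext; simp
    refine ⟨hX.eigenvectorUnitary, hX.eigenvalues, ?_, ?_, ?_⟩
    · rw [← hs]; exact Unitary.coe_star_mul_self _
    · rw [← hs]; exact Unitary.coe_mul_star_self _
    · have := hX.spectral_theorem
      rw [Unitary.conjStarAlgAut_apply] at this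
      rw [← hs]
      exact this
  simp only [Ek_eq hn U X l hU hU' hXe]
  rw [scalar_main hn, diag_main, conj_main U X l hU hU' hXe]
  have hquad : ∀ x : Fin d → ℝ, star x ⬝ᵥ
      ((Matrix.of fun i j => (B i * X * B j).trace : Matrix (Fin d) (Fin d) ℝ) *ᵥ x) =
      ((∑ i, x i • B i) * X * (∑ i, x i • B i)).trace := by
    intro x
    simp only [dotProduct, Matrix.mulVec, Matrix.of_apply, Finset.sum_mul, Finset.mul_sum,
      Matrix.trace_sum, Matrix.smul_mul, Matrix.mul_smul, Matrix.trace_smul, smul_eq_mul,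
      Pi.star_apply, star_trivial]
    try rw [Finset.sum_comm]
    refine Finset.sum_congr rfl fun i _ => Finset.sum_congr rfl fun j _ => ?_
    ring
  constructor
  · intro H
    refine .of_dotProduct_mulVec_nonneg ?_ fun x => ?_
    · ext i j
      simp only [Matrix.conjTranspose_apply, Matrix.of_apply, star_trivial]
      have hT : ∀ M : Matrix (Fin n) (Fin n) ℝ, M.IsHermitian → Mᵀ = M := fun M hM => by
        simpa using hM.eq
      rw [← Matrix.trace_transpose, Matrix.transpose_mul, Matrix.transpose_mul, hT _ (hBsym _),
        hT _ (hBsym _), hT _ hX, Matrix.mul_assoc]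
    · rw [hquad]
      refine H _ ?_ ?_
      · simp only [Matrix.IsHermitian, Matrix.conjTranspose_sum, Matrix.conjTranspose_smul,
          star_trivial, (hBsym _).eq]
      · simp [Matrix.trace_sum, hBtr]
  · intro H A hA hT
    obtain ⟨x, rfl⟩ := (Submodule.mem_span_range_iff_exists_fun ℝ).1 (hBspan A hA hT)
    rw [← hquad]
    exact H.dotProduct_mulVec_nonneg x
end

section
/- Let n ≥ 2. A real symmetric n×n matrix X belongs to S^{n,1} if and only if tr(Y X Y) ≥ 0 for every real symmetric n×n matrix Y with tr(Y) = 0. -/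
open Matrix Finset

/-- two vanishing factors -/
theorem q_two_zero {n : ℕ} (m : Fin n → ℝ) (a b : Fin n) (hab : a ≠ b) (ha : m a = 0)
    (hb : m b = 0) : ∑ i, ∏ j ∈ univ.erase i, m j = 0 := by
  apply Finset.sum_eq_zero
  intro i _
  by_cases h : a = i
  · exact Finset.prod_eq_zero (i := b) (by simp; rw [← h]; exact hab.symm) hb
  · exact Finset.prod_eq_zero (i := a) (by simp [h]) ha

theorem q_nonzero {n : ℕ} (m : Fin n → ℝ) (h : ∀ i, m i ≠ 0) :
    ∑ i, ∏ j ∈ univ.erase i, m j = (∏ j, m j) * ∑ i, (m i)⁻¹ := by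
  rw [Finset.mul_sum]
  refine Finset.sum_congr rfl fun i _ => ?_
  rw [← Finset.mul_prod_erase univ m (Finset.mem_univ i)]
  field_simp [h i]

theorem q_zero {n : ℕ} (m : Fin n → ℝ) (a : Fin n) (h : m a = 0) :
    ∑ i, ∏ j ∈ univ.erase i, m j = ∏ j ∈ univ.erase a, m j := by
  refine Finset.sum_eq_single_of_mem a (mem_univ a) fun i _ hi => ?_
  exact Finset.prod_eq_zero (i := a) (by simp [hi.symm]) h

theorem lem_neg_eig {n : ℕ} (hn : 2 ≤ n) (l : Fin n → ℝ) (y : Fin n → ℝ) (hy : ∑ i, y i = 0)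
    (hneg : ∑ i, l i * y i ^ 2 < 0) :
    ∃ (t : ℝ) (v : Fin n → ℝ) (c : ℝ), t < 0 ∧ v ≠ 0 ∧ ∑ i, v i = 0 ∧
      ∀ i, (l i - t) * v i = c := by
  set P : Matrix (Fin n) (Fin n) ℝ := 1 - (n : ℝ)⁻¹ • Matrix.of (fun _ _ => (1 : ℝ)) with hP
  have hn0 : (n : ℝ) ≠ 0 := by positivity
  have hPv : ∀ x : Fin n → ℝ, ∀ i, (P *ᵥ x) i = x i - (n : ℝ)⁻¹ * ∑ j, x j := by
    intro x i
    rw [hP, Matrix.sub_mulVec, Matrix.smul_mulVec]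
    simp [Matrix.mulVec, dotProduct]
  have hPs : P.IsHermitian := by
    ext i j
    simp [hP, Matrix.one_apply, eq_comm]
  have hPsum : ∀ x : Fin n → ℝ, ∑ i, (P *ᵥ x) i = 0 := by
    intro x
    simp_rw [hPv]
    simp [Finset.sum_sub_distrib]
    field_simp
    simp
  have hM : (Pᴴ * diagonal l * P).IsHermitian :=
    isHermitian_conjTranspose_mul_mul P (by simp [IsHermitian, diagonal_conjTranspose])
  have hnot : ¬ (Pᴴ * diagonal l * P).PosSemidef := by
    intro h
    have h1 := h.dotProduct_mulVec_nonneg y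
    have hPy : P *ᵥ y = y := by
      ext i; rw [hPv, hy]; simp
    have : star y ⬝ᵥ ((Pᴴ * diagonal l * P) *ᵥ y) = ∑ i, l i * y i ^ 2 := by
      rw [← mulVec_mulVec, hPy, ← mulVec_mulVec, dotProduct_mulVec, ← star_mulVec, hPy]
      simp only [dotProduct, mulVec_diagonal]
      refine Finset.sum_congr rfl fun i _ => ?_
      simp; ring
    linarith
  rw [hM.posSemidef_iff_eigenvalues_nonneg, Pi.le_def] at hnot
  push Not at hnot
  obtain ⟨i, hi⟩ := hnot
  simp only [Pi.zero_apply] at hi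
  have hv := hM.mulVec_eigenvectorBasis i
  set t := hM.eigenvalues i
  set v : Fin n → ℝ := ⇑(hM.eigenvectorBasis i) with hvdef
  have hv0 : v ≠ 0 := by
    have := hM.eigenvectorBasis.orthonormal.ne_zero i
    intro h
    apply this
    ext j
    exact congrFun h j
  rw [hPs.eq, ← mulVec_mulVec, ← mulVec_mulVec] at hv
  have hs : ∑ i, v i = 0 := by
    have h := hPsum (diagonal l *ᵥ P *ᵥ v)
    rw [hv] at h
    simp only [Pi.smul_apply, smul_eq_mul, ← Finset.mul_sum] at h
    exact (mul_eq_zero.mp h).resolve_left hi.ne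
  have hPvv : P *ᵥ v = v := by
    ext i; rw [hPv, hs]; simp
  rw [hPvv] at hv
  refine ⟨t, v, (n : ℝ)⁻¹ * ∑ j, (diagonal l *ᵥ v) j, hi, hv0, hs, fun k => ?_⟩
  have := congrFun hv k
  rw [hPv] at this
  simp only [mulVec_diagonal, Pi.smul_apply, smul_eq_mul] at this ⊢
  linarith

theorem lem_diag {n : ℕ} (hn : 2 ≤ n) (l : Fin n → ℝ) :
    (∀ t : ℝ, ∑ i, ∏ j ∈ univ.erase i, (l j - t) = 0 → 0 ≤ t) ↔
      ∀ y : Fin n → ℝ, ∑ i, y i = 0 → 0 ≤ ∑ i, l i * y i ^ 2 := by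
  constructor
  · intro h y hy
    by_contra! hneg
    obtain ⟨t, v, c, ht, hv0, hs, hv⟩ := lem_neg_eig hn l y hy hneg
    refine absurd (h t ?_) (not_le.mpr ht)
    by_cases hc : c = 0
    · obtain ⟨a, ha⟩ := Function.ne_iff.mp hv0
      simp only [Pi.zero_apply] at ha
      have : ∃ b, b ≠ a ∧ v b ≠ 0 := by
        by_contra! hb
        rw [Finset.sum_eq_single_of_mem a (mem_univ a) fun i _ hi => hb i hi] at hs
        exact ha hs
      obtain ⟨b, hba, hb⟩ := this
      subst hc
      exact q_two_zero (fun j => l j - t) a b hba.symm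
        ((mul_eq_zero.mp (hv a)).resolve_right ha) ((mul_eq_zero.mp (hv b)).resolve_right hb)
    · have hm : ∀ i, l i - t ≠ 0 := by
        intro i hi
        apply hc
        rw [← hv i, hi, zero_mul]
      rw [q_nonzero (fun j => l j - t) hm]
      have : c * ∑ i, (l i - t)⁻¹ = 0 := by
        rw [← hs, Finset.mul_sum]
        refine Finset.sum_congr rfl fun i _ => ?_
        rw [← hv i]
        field_simp [hm i]
      rw [(mul_eq_zero.mp this).resolve_left hc, mul_zero]
  · intro h t ht
    by_contra! hneg
    have key : ∀ y : Fin n → ℝ, ∑ i, y i = 0 → ∑ i, (l i - t) * y i ^ 2 = 0 → ∀ i, y i = 0 := by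
      intro y hy h0 i
      have h1 := h y hy
      have h2 : ∑ i, l i * y i ^ 2 = t * ∑ i, y i ^ 2 := by
        rw [Finset.mul_sum, ← sub_eq_zero, ← Finset.sum_sub_distrib, ← h0]
        exact Finset.sum_congr rfl fun i _ => by ring
      have h3 : y i ^ 2 ≤ ∑ i, y i ^ 2 :=
        Finset.single_le_sum (f := fun i => y i ^ 2) (fun i _ => sq_nonneg _) (mem_univ i)
      have h4 : y i ^ 2 ≤ 0 := by
        by_contra! h5
        nlinarith
      exact pow_eq_zero_iff (two_ne_zero) |>.mp (le_antisymm h4 (sq_nonneg _))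
    by_cases hm : ∀ i, l i - t ≠ 0
    · rw [q_nonzero (fun j => l j - t) hm] at ht
      have hs := (mul_eq_zero.mp ht).resolve_left (Finset.prod_ne_zero_iff.mpr fun i _ => hm i)
      have := key (fun i => (l i - t)⁻¹) hs (by
        rw [← hs]
        refine Finset.sum_congr rfl fun i _ => ?_
        field_simp [hm i]) ⟨0, by omega⟩
      exact hm _ (inv_eq_zero.mp this)
    · push Not at hm
      obtain ⟨a, ha⟩ := hm
      rw [q_zero (fun j => l j - t) a ha, Finset.prod_eq_zero_iff] at ht
      obtain ⟨b, hb, hb0⟩ := ht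
      have hba : b ≠ a := by simpa using hb
      have := key (Pi.single a 1 - Pi.single b 1) (by simp) (by
        apply Finset.sum_eq_zero
        intro i _
        by_cases h1 : i = a
        · subst h1; simp [ha]
        · by_cases h2 : i = b
          · subst h2; simp [hb0]
          · simp [h1, h2]) a
      simp [hba.symm] at this

theorem lem_full {n : ℕ} (l : Fin n → ℝ)
    (h : ∀ y : Fin n → ℝ, ∑ i, y i = 0 → 0 ≤ ∑ i, l i * y i ^ 2)
    (Y : Matrix (Fin n) (Fin n) ℝ) (hY : Y.IsHermitian) (ht : Y.trace = 0) :
    0 ≤ ∑ i, ∑ j, l i * Y i j ^ 2 := by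
  have hpair : ∀ a b, a ≠ b → 0 ≤ l a + l b := by
    intro a b hab
    have h1 := h (Pi.single a 1 - Pi.single b 1) (by simp)
    have h2 : ∑ i, l i * (Pi.single a 1 - Pi.single b 1 : Fin n → ℝ) i ^ 2
        = ∑ i, (l i * (Pi.single a 1 : Fin n → ℝ) i + l i * (Pi.single b 1 : Fin n → ℝ) i) := by
      refine Finset.sum_congr rfl fun i _ => ?_
      by_cases h1 : i = a
      · subst h1; simp [hab]
      · by_cases h2 : i = b
        · subst h2; simp [Pi.single_eq_of_ne hab.symm]
        · simp [h1, h2]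
    rw [h2, Finset.sum_add_distrib] at h1
    simpa [Pi.single_apply] using h1
  have hsym : ∀ i j, Y j i = Y i j := fun i j => by simpa using hY.apply i j
  have hd : 0 ≤ ∑ i, l i * Y i i ^ 2 := h (fun i => Y i i) ht
  have e1 : ∑ i, ∑ j, l i * Y i j ^ 2 = ∑ i, ∑ j, l j * Y i j ^ 2 := by
    rw [Finset.sum_comm]
    refine Finset.sum_congr rfl fun i _ => Finset.sum_congr rfl fun j _ => ?_
    rw [hsym]
  have e2 : 2 * ∑ i, ∑ j, l i * Y i j ^ 2 = ∑ i, ∑ j, (l i + l j) * Y i j ^ 2 := by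
    rw [two_mul]
    nth_rewrite 2 [e1]
    simp only [← Finset.sum_add_distrib, add_mul]
  have e3 : ∑ i, 2 * (l i * Y i i ^ 2) ≤ ∑ i, ∑ j, (l i + l j) * Y i j ^ 2 := by
    refine Finset.sum_le_sum fun i _ => ?_
    rw [← Finset.add_sum_erase univ _ (mem_univ i)]
    have : 0 ≤ ∑ j ∈ univ.erase i, (l i + l j) * Y i j ^ 2 := by
      refine Finset.sum_nonneg fun j hj => mul_nonneg (hpair i j ?_) (sq_nonneg _)
      simpa using (Finset.ne_of_mem_erase hj).symm
    linarith
  rw [← Finset.mul_sum] at e3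
  linarith

theorem lem_tr {n : ℕ} (l : Fin n → ℝ) (Z : Matrix (Fin n) (Fin n) ℝ) (hZ : Z.IsHermitian) :
    (Z * diagonal l * Z).trace = ∑ i, ∑ j, l i * Z i j ^ 2 := by
  have hsym : ∀ i j, Z j i = Z i j := fun i j => by simpa using hZ.apply i j
  have h0 : (Z * diagonal l * Z).trace = ∑ j, ∑ i, Z j i * l i * Z i j := by
    simp only [Matrix.trace, Matrix.diag_apply]
    refine Finset.sum_congr rfl fun j _ => ?_
    rw [Matrix.mul_apply]
    refine Finset.sum_congr rfl fun i _ => ?_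
    rw [mul_diagonal]
  rw [h0, Finset.sum_comm]
  refine Finset.sum_congr rfl fun i _ => Finset.sum_congr rfl fun j _ => ?_
  rw [hsym i j]; ring

theorem stmt1 {n : ℕ} (hn : 2 ≤ n) (X : Matrix (Fin n) (Fin n) ℝ) (hX : X.IsHermitian) :
    (∀ t : ℝ, Ek n (n - 1) (X - t • 1) = 0 → 0 ≤ t) ↔
      ∀ Y : Matrix (Fin n) (Fin n) ℝ, Y.IsHermitian → Y.trace = 0 →
        0 ≤ (Y * X * Y).trace := by
  obtain ⟨U, V, l, hUV, hVU, hVs, hXe⟩ : ∃ (U V : Matrix (Fin n) (Fin n) ℝ) (l : Fin n → ℝ),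
      U * V = 1 ∧ V * U = 1 ∧ V = Uᴴ ∧ X = U * diagonal l * V := by
    refine ⟨hX.eigenvectorUnitary, star (hX.eigenvectorUnitary : Matrix (Fin n) (Fin n) ℝ),
      hX.eigenvalues, by simp, by simp, rfl, ?_⟩
    have := hX.spectral_theorem
    rw [Unitary.conjStarAlgAut_apply] at this
    exact this
  have hE : ∀ t : ℝ, Ek n (n - 1) (X - t • 1) = ∑ i, ∏ j ∈ univ.erase i, (l j - t) := by
    intro t
    have h1 : -(X - t • 1) = U * diagonal (fun i => t - l i) * V := by
      have : diagonal (fun i => t - l i) = t • (1 : Matrix (Fin n) (Fin n) ℝ) - diagonal l := by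
        ext i j; by_cases h : i = j
        · subst h; simp
        · simp [h]
      rw [this, mul_sub, sub_mul, ← hXe]
      simp [hUV]
    have hcp : (-(X - t • 1)).charpoly
        = ∏ i, (Polynomial.X - Polynomial.C (t - l i)) := by
      rw [h1, charpoly_mul_comm, ← mul_assoc, hVU, one_mul, charpoly_diagonal]
    unfold Ek
    rw [hcp, show n - (n - 1) = 0 + 1 by omega]
    have h2 := Polynomial.coeff_derivative (∏ i, (Polynomial.X - Polynomial.C (t - l i))) 0
    simp only [Nat.cast_zero, zero_add, mul_one] at h2 ⊢
    rw [← h2, Polynomial.derivative_prod_finset, Polynomial.coeff_zero_eq_eval_zero,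
      Polynomial.eval_finset_sum]
    simp [Polynomial.eval_prod]
  simp_rw [hE]
  rw [lem_diag hn l]
  constructor
  · intro h Y hY ht
    have hZ : (V * Y * U).IsHermitian := by
      rw [hVs]; exact isHermitian_conjTranspose_mul_mul U hY
    have htZ : (V * Y * U).trace = 0 := by
      rw [trace_mul_comm, ← mul_assoc, hUV, one_mul, ht]
    have := lem_full l h _ hZ htZ
    rw [← lem_tr l _ hZ] at this
    have e : V * Y * U * diagonal l * (V * Y * U) = V * (Y * X * Y * U) := by
      rw [hXe]; simp only [mul_assoc]
    rw [e, trace_mul_comm, mul_assoc, hUV, mul_one] at this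
    exact this
  · intro h y hy
    have hD : (diagonal y).IsHermitian := by simp [IsHermitian, diagonal_conjTranspose]
    have hYh : (U * diagonal y * V).IsHermitian := by
      rw [hVs]; exact isHermitian_mul_mul_conjTranspose U hD
    have := h (U * diagonal y * V) hYh (by
      rw [trace_mul_comm, ← mul_assoc, hVU, one_mul, trace_diagonal, hy])
    have e : U * diagonal y * V * X * (U * diagonal y * V)
        = U * (diagonal y * diagonal l * diagonal y * V) := by
      rw [hXe]
      calc _ = U * diagonal y * (V * U) * diagonal l * (V * U) * diagonal y * V := by
            simp only [mul_assoc]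
        _ = _ := by rw [hVU]; simp only [mul_assoc, one_mul, mul_one]
    rw [e, trace_mul_comm, mul_assoc, hVU, mul_one, diagonal_mul_diagonal,
      diagonal_mul_diagonal, trace_diagonal] at this
    convert this using 2
    ring
end

section
/- Let n ≥ 2. If a real symmetric n×n matrix X belongs to S^{n,1}, then λ_i(X) + λ_j(X) ≥ 0 for every pair of indices i ≠ j; that is, the sum of any two eigenvalues of X is nonnegative. -/
open Matrix Finset

lemma charpoly_aux {n : ℕ} (X : Matrix (Fin n) (Fin n) ℝ) (hX : X.IsHermitian) (t : ℝ) :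
    Matrix.charpoly (-(X - t • (1 : Matrix (Fin n) (Fin n) ℝ))) =
      ∏ k, (Polynomial.X + Polynomial.C (hX.eigenvalues k - t)) := by
  apply Polynomial.funext
  intro s
  have h1 := Matrix.eval_charpoly X (t - s)
  rw [hX.charpoly_eq] at h1
  rw [Matrix.eval_charpoly]
  have : Matrix.scalar (Fin n) s - -(X - t • (1 : Matrix (Fin n) (Fin n) ℝ))
      = -(Matrix.scalar (Fin n) (t - s) - X) := by
    ext i j
    by_cases h : i = j <;> simp [h, Matrix.one_apply, Matrix.diagonal_apply] <;> ring
  rw [this, Matrix.det_neg, ← h1]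
  simp only [Polynomial.eval_prod, Fintype.card_fin]
  have : (-1 : ℝ) ^ n = ∏ k : Fin n, (-1 : ℝ) := by simp
  rw [this, ← Finset.prod_mul_distrib]
  apply Finset.prod_congr rfl
  intro k _
  simp
  ring

lemma Ek_aux {n : ℕ} (hn : 2 ≤ n) (X : Matrix (Fin n) (Fin n) ℝ) (hX : X.IsHermitian) (t : ℝ) :
    Ek n (n - 1) (X - t • 1) = ∑ i, ∏ k ∈ univ.erase i, (hX.eigenvalues k - t) := by
  have h1 : n - (n - 1) = 1 := by omega
  unfold Ek
  rw [h1, charpoly_aux X hX t]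
  have := Polynomial.coeff_derivative
    (∏ k, (Polynomial.X + Polynomial.C (hX.eigenvalues k - t))) 0
  simp only [Nat.cast_zero, zero_add, mul_one] at this
  rw [← this, Polynomial.derivative_prod_finset, Polynomial.coeff_zero_eq_eval_zero,
    Polynomial.eval_finset_sum]
  apply Finset.sum_congr rfl
  intro i _
  simp [Polynomial.eval_prod]

lemma real_aux {n : ℕ} (l : Fin n → ℝ)
    (h : ∀ t : ℝ, ∑ i, ∏ k ∈ univ.erase i, (l k - t) = 0 → 0 ≤ t) :
    ∀ i j : Fin n, i ≠ j → l i ≤ l j → 0 ≤ l i + l j := by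
  -- at most one negative entry
  have A : ∀ i j : Fin n, i ≠ j → l i ≤ l j → 0 ≤ l j := by
    intro i j hij hle
    rcases hle.lt_or_eq with hlt | heq
    · have hd : ∀ x : ℝ, HasDerivAt (fun t => ∏ k, (l k - t))
          (∑ i, (∏ k ∈ univ.erase i, (l k - x)) • (-1 : ℝ)) x := by
        intro x
        apply HasDerivAt.fun_finsetProd
        intro k _
        simpa using (hasDerivAt_id x).const_sub (l k)
      have hz : ∀ a, ∏ k, (l k - l a) = 0 := fun a =>
        Finset.prod_eq_zero (Finset.mem_univ a) (by simp)
      obtain ⟨c, hc, hc0⟩ := exists_hasDerivAt_eq_zero hlt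
        (fun x _ => (hd x).continuousAt.continuousWithinAt)
        (by simp only [hz]) (fun x _ => hd x)
      have := h c (by simpa using hc0)
      exact this.trans hc.2.le
    · apply h
      apply Finset.sum_eq_zero
      intro a _
      by_cases ha : a = j
      · exact Finset.prod_eq_zero (i := i) (by simp [ha, hij]) (by simp [heq])
      · exact Finset.prod_eq_zero (i := j) (by simp [Ne.symm ha]) (by simp)
  intro a b hab hle
  by_contra! hneg
  have ha : l a < 0 := by linarith
  have hb := A a b hab hle
  have hpos : ∀ k, k ≠ a → 0 ≤ l k := by
    intro k hk
    rcases le_total (l a) (l k) with h1 | h1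
    · exact A a k hk.symm h1
    · exact absurd (A k a hk h1) (by linarith)
  set e : ℝ := -(l a + l b) / 4 with he
  have he0 : 0 < e := by rw [he]; linarith
  have hcont : Continuous (fun t : ℝ => ∑ i, ∏ k ∈ univ.erase i, (l k - t)) := by fun_prop
  have hfa : 0 ≤ ∑ i, ∏ k ∈ univ.erase i, (l k - l a) := by
    apply Finset.sum_nonneg
    intro i _
    apply Finset.prod_nonneg
    intro k _
    by_cases hk : k = a
    · simp [hk]
    · linarith [hpos k hk]
  have hfe : ∑ i, ∏ k ∈ univ.erase i, (l k - (-e)) ≤ 0 := by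
    have hba : b ∈ univ.erase a := by simp [hab.symm]
    have hab' : a ∈ univ.erase b := by simp [hab]
    rw [← Finset.add_sum_erase _ _ (Finset.mem_univ a), ← Finset.add_sum_erase _ _ hba,
      ← Finset.mul_prod_erase _ _ hba, ← Finset.mul_prod_erase _ _ hab',
      Finset.erase_right_comm (a := b) (b := a), ← add_assoc, ← add_mul]
    have h1 : 0 ≤ ∏ k ∈ (univ.erase a).erase b, (l k - -e) := by
      apply Finset.prod_nonneg
      intro k hk
      simp at hk
      linarith [hpos k hk.2]
    have h2 : ∑ i ∈ (univ.erase a).erase b, ∏ k ∈ univ.erase i, (l k - -e) ≤ 0 := by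
      apply Finset.sum_nonpos
      intro i hi
      simp at hi
      have hai : a ∈ univ.erase i := by simp [Ne.symm hi.2]
      rw [← Finset.mul_prod_erase _ _ hai]
      apply mul_nonpos_of_nonpos_of_nonneg
      · rw [he]; linarith
      · apply Finset.prod_nonneg
        intro k hk
        simp at hk
        linarith [hpos k hk.1]
    have h3 : (l b - -e + (l a - -e)) ≤ 0 := by rw [he]; linarith
    have := mul_nonpos_of_nonpos_of_nonneg h3 h1
    linarith
  obtain ⟨c, hc, hc0⟩ := intermediate_value_Icc' (a := l a) (b := -e)
    (by rw [he]; linarith) hcont.continuousOn ⟨hfe, hfa⟩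
  have := h c hc0
  linarith [hc.2]

theorem stmt4 {n : ℕ} (hn : 2 ≤ n) (X : Matrix (Fin n) (Fin n) ℝ) (hX : X.IsHermitian)
    (hmem : ∀ t : ℝ, Ek n (n - 1) (X - t • 1) = 0 → 0 ≤ t) :
    ∀ i j : Fin n, i ≠ j → 0 ≤ hX.eigenvalues i + hX.eigenvalues j := by
  have key := real_aux hX.eigenvalues (fun t ht => hmem t (by rw [Ek_aux hn X hX t]; exact ht))
  intro i j hij
  rcases le_total (hX.eigenvalues i) (hX.eigenvalues j) with h | h
  · exact key i j hij h
  · rw [add_comm]; exact key j i hij.symm h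
end

section
/- Let n ≥ 2 and d = n(n+1)/2 − 1, and let B_1, …, B_d be a basis of the space of n×n real symmetric matrices with trace zero. Let 𝓑(X) be the d×d matrix with (i,j) entry tr(B_i X B_j), and let q(X) = ∏_{1 ≤ i < j ≤ n} (λ_i(X) + λ_j(X)). Then there exists a positive real constant c (depending on the choice of basis) such that for every real symmetric n×n matrix X, c · q(X) · E_{n−1}(X) = det(𝓑(X)). -/
open Matrix Finset

/-- `q hX = ∏_{i < j} (λᵢ(X) + λⱼ(X))` where `λ` are the eigenvalues of the
real symmetric matrix `X`. -/
noncomputable def q {n : ℕ} {X : Matrix (Fin n) (Fin n) ℝ} (hX : X.IsHermitian) : ℝ :=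
  ∏ p ∈ Finset.univ.filter (fun p : Fin n × Fin n => p.1 < p.2),
    (hX.eigenvalues p.1 + hX.eigenvalues p.2)

namespace Stmt5Aux

lemma rankOne_ne {m : ℕ} (a : ℝ) (v : Fin m → ℝ) (hv : ∀ i, v i ≠ 0) :
    (Matrix.diagonal v + Matrix.of fun _ _ => a).det =
      ∏ i, v i + a * ∑ i, ∏ j ∈ Finset.univ.erase i, v j := by
  have h1 : (Matrix.of fun _ _ => a : Matrix (Fin m) (Fin m) ℝ) =
      replicateCol Unit (fun _ => a) * replicateRow Unit (fun _ => (1 : ℝ)) := by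
    ext i j; simp [Matrix.mul_apply]
  have hdet : IsUnit (Matrix.diagonal v).det := by
    rw [Matrix.det_diagonal, isUnit_iff_ne_zero]
    exact Finset.prod_ne_zero_iff.mpr fun i _ => hv i
  have hinv : (Matrix.diagonal v)⁻¹ = Matrix.diagonal (fun i => (v i)⁻¹) := by
    apply Matrix.inv_eq_right_inv
    rw [Matrix.diagonal_mul_diagonal, ← Matrix.diagonal_one]
    congr 1; ext i; simp [hv i]
  rw [h1, det_add_replicateCol_mul_replicateRow hdet, hinv, Matrix.det_diagonal, Matrix.det_unique]
  have h2 : ∀ i, ∏ j ∈ Finset.univ.erase i, v j = (∏ j, v j) * (v i)⁻¹ := by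
    intro i
    rw [← Finset.mul_prod_erase Finset.univ v (Finset.mem_univ i)]
    field_simp [hv i]
  simp only [h2, ← Finset.mul_sum]
  simp [Matrix.mul_apply, Matrix.diagonal_apply, ← Finset.sum_mul]
  ring

lemma rankOne {m : ℕ} (a : ℝ) (v : Fin m → ℝ) :
    (Matrix.diagonal v + Matrix.of fun _ _ => a).det =
      ∏ i, v i + a * ∑ i, ∏ j ∈ Finset.univ.erase i, v j := by
  let f : ℝ → ℝ := fun t => (Matrix.diagonal (fun i => v i + t) + Matrix.of fun _ _ => a).det
  let g : ℝ → ℝ := fun t => ∏ i, (v i + t) + a * ∑ i, ∏ j ∈ Finset.univ.erase i, (v j + t)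
  have hf : Continuous f := by
    refine Continuous.matrix_det (Continuous.add (Continuous.matrix_diagonal ?_) continuous_const)
    fun_prop
  have hg : Continuous g := by fun_prop
  have hfg : ∀ᶠ t in nhdsWithin (0 : ℝ) {0}ᶜ, f t = g t := by
    have : ∀ᶠ t in nhdsWithin (0 : ℝ) {0}ᶜ, ∀ i, v i + t ≠ 0 := by
      rw [Filter.eventually_all]
      intro i
      by_cases h : v i = 0
      · filter_upwards [self_mem_nhdsWithin] with t ht
        simpa [h] using ht
      · apply Filter.Eventually.filter_mono nhdsWithin_le_nhds
        have : ContinuousAt (fun t : ℝ => v i + t) 0 := by fun_prop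
        exact this.eventually_ne (by simpa using h)
    filter_upwards [this] with t ht
    exact rankOne_ne a _ ht
  have h1 := (hf.tendsto 0).mono_left (nhdsWithin_le_nhds (s := {0}ᶜ))
  have h2 := (hg.tendsto 0).mono_left (nhdsWithin_le_nhds (s := {0}ᶜ))
  have := tendsto_nhds_unique (h1.congr' hfg) h2
  simpa [f, g] using this

abbrev Idx (m : ℕ) := {p : Fin (m + 1) × Fin (m + 1) // p.1 < p.2} ⊕ Fin m

noncomputable def S (m : ℕ) : Idx m → Matrix (Fin (m + 1)) (Fin (m + 1)) ℝ
  | Sum.inl p => Matrix.single p.1.1 p.1.2 1 + Matrix.single p.1.2 p.1.1 1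
  | Sum.inr i => Matrix.diagonal (Pi.single i.succ 1 - Pi.single 0 1)

lemma S_symm (m : ℕ) (k : Idx m) : (S m k)ᵀ = S m k := by
  rcases k with p | i
  · simp [S, add_comm]
  · simp [S]

lemma S_trace (m : ℕ) (k : Idx m) : (S m k).trace = 0 := by
  rcases k with ⟨p, hp⟩ | i
  · simp [S, Matrix.trace_single_eq_of_ne, hp.ne, hp.ne']
  · simp [S, Matrix.trace_diagonal]

lemma card_Idx (m : ℕ) : Fintype.card (Idx m) = (m + 1) * (m + 1 + 1) / 2 - 1 := by
  have h : Fintype.card {p : Fin (m + 1) × Fin (m + 1) // p.1 < p.2} = (m + 1) * m / 2 := by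
    rw [Fintype.card_subtype, Finset.card_filter, Fintype.sum_prod_type_right]
    have : ∀ y : Fin (m + 1), (∑ x : Fin (m + 1), if x < y then 1 else 0) = (y : ℕ) := by
      intro y
      rw [← Finset.card_filter, Finset.filter_gt_eq_Iio, Fin.card_Iio]
    simp only [this]
    rw [Fin.sum_univ_eq_sum_range (fun i => i), Finset.sum_range_id]
    simp
  rw [Fintype.card_sum, h, Fintype.card_fin]
  have : (m + 1) * (m + 1 + 1) = (m + 1) * m + 2 * (m + 1) := by ring
  omega

noncomputable def E1 {n : ℕ} (v : Fin n → ℝ) : ℝ := ∑ i, ∏ j ∈ Finset.univ.erase i, v j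

lemma E1_succ {m : ℕ} (v : Fin (m + 1) → ℝ) :
    E1 v = ∏ i : Fin m, v i.succ +
      v 0 * ∑ i : Fin m, ∏ j ∈ Finset.univ.erase i, v j.succ := by
  unfold E1
  rw [Fin.sum_univ_succ, Finset.mul_sum]
  congr 1
  · rw [← Finset.prod_image (g := Fin.succ) (f := v) (s := Finset.univ)
      (fun _ _ _ _ h => Fin.succ_injective _ h)]
    congr 1
    ext j
    refine Fin.cases ?_ (fun j => ?_) j <;> simp
  · apply Finset.sum_congr rfl
    intro i _
    rw [← Finset.mul_prod_erase _ v (a := 0) (by simp [(Fin.succ_ne_zero i).symm])]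
    congr 1
    rw [← Finset.prod_image (g := Fin.succ) (f := v)
      (fun _ _ _ _ h => Fin.succ_injective _ h)]
    congr 1
    ext j
    refine Fin.cases ?_ (fun j => ?_) j <;> simp

lemma det_S {m : ℕ} (v : Fin (m + 1) → ℝ) :
    (Matrix.of fun i j => (S m i * Matrix.diagonal v * S m j).trace :
      Matrix (Idx m) (Idx m) ℝ).det =
    (∏ p ∈ Finset.univ.filter (fun p : Fin (m + 1) × Fin (m + 1) => p.1 < p.2),
      (v p.1 + v p.2)) * E1 v := by
  have hM : (Matrix.of fun i j => (S m i * Matrix.diagonal v * S m j).trace :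
      Matrix (Idx m) (Idx m) ℝ) =
      Matrix.fromBlocks (Matrix.diagonal fun p => v p.1.1 + v p.1.2) 0 0
        (Matrix.diagonal (fun i : Fin m => v i.succ) + Matrix.of fun _ _ => v 0) := by
    ext a b
    rcases a with ⟨⟨i, j⟩, hij⟩ | i <;> rcases b with ⟨⟨k, l⟩, hkl⟩ | k
    · simp only [S, Matrix.of_apply, Matrix.fromBlocks_apply₁₁, Matrix.diagonal_apply,
        Subtype.mk.injEq, Prod.mk.injEq]
      have hs : ∀ a b c d : Fin (m + 1), (Matrix.single a b (1:ℝ) * Matrix.diagonal v *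
          Matrix.single c d (1:ℝ)).trace = if b = c ∧ a = d then v b else 0 := by
        intro a b c d
        simp only [Matrix.trace_mul_single, Matrix.mul_diagonal, Matrix.single_apply]
        by_cases h1 : b = c <;> by_cases h2 : a = d <;> simp [h1, h2]
      simp only [Matrix.add_mul, Matrix.mul_add, Matrix.trace_add, hs]
      simp only at hij hkl
      have e1 : ¬ (j = k ∧ i = l) := by rintro ⟨rfl, rfl⟩; exact absurd hij (not_lt.mpr hkl.le)
      have e2 : ¬ (i = l ∧ j = k) := fun h => e1 h.symm
      by_cases h : i = k ∧ j = l
      · obtain ⟨rfl, rfl⟩ := h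
        simp [hij.ne, hij.ne', add_comm]
      · have h' : ¬ (j = l ∧ i = k) := fun h' => h h'.symm
        simp [e1, e2, h, h']
    · simp [S, Matrix.add_mul, Matrix.mul_assoc, Matrix.diagonal_mul_diagonal,
        Matrix.trace_single_mul, Matrix.diagonal_apply, hij.ne, hij.ne']
    · simp [S, Matrix.mul_add, Matrix.diagonal_mul_diagonal,
        Matrix.trace_mul_single, Matrix.diagonal_apply, hkl.ne, hkl.ne']
    · simp only [S, Matrix.of_apply, Matrix.fromBlocks_apply₂₂, Matrix.diagonal_mul_diagonal,
        Matrix.trace_diagonal, Fin.sum_univ_succ, Matrix.add_apply]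
      simp [Pi.single_apply, Matrix.diagonal_apply, add_comm]
      by_cases h : i = k
      · subst h; simp
      · simp [h, Ne.symm h]
  rw [hM, Matrix.det_fromBlocks_zero₂₁, Matrix.det_diagonal, rankOne, E1_succ]
  congr 1
  rw [Finset.prod_subtype (p := fun p : Fin (m + 1) × Fin (m + 1) => p.1 < p.2)]
  simp

lemma main_id {m d : ℕ} (hd : d = (m + 1) * (m + 1 + 1) / 2 - 1)
    (B : Fin d → Matrix (Fin (m + 1)) (Fin (m + 1)) ℝ)
    (hBspan : ∀ A : Matrix (Fin (m + 1)) (Fin (m + 1)) ℝ, A.IsHermitian → A.trace = 0 →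
      A ∈ Submodule.span ℝ (Set.range B))
    (U : Matrix (Fin (m + 1)) (Fin (m + 1)) ℝ) (hU : Uᵀ * U = 1) :
    ∃ r : ℝ, 0 ≤ r ∧ ∀ v : Fin (m + 1) → ℝ,
      r * (Matrix.of fun i j => (B i * (U * Matrix.diagonal v * Uᵀ) * B j).trace :
        Matrix (Fin d) (Fin d) ℝ).det =
      (∏ p ∈ Finset.univ.filter (fun p : Fin (m + 1) × Fin (m + 1) => p.1 < p.2),
        (v p.1 + v p.2)) * E1 v := by
  have hc : Fintype.card (Idx m) = Fintype.card (Fin d) := by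
    rw [card_Idx, Fintype.card_fin, hd]
  let e : Fin d ≃ Idx m := (Fintype.equivOfCardEq hc).symm
  have hS : ∀ k : Fin d, ∃ c : Fin d → ℝ, ∑ i, c i • B i = U * S m (e k) * Uᵀ := by
    intro k
    apply (Submodule.mem_span_range_iff_exists_fun ℝ).mp
    apply hBspan
    · rw [Matrix.IsHermitian, Matrix.conjTranspose_eq_transpose_of_trivial]
      simp [Matrix.transpose_mul, S_symm, Matrix.mul_assoc]
    · rw [Matrix.trace_mul_comm, ← Matrix.mul_assoc, hU, Matrix.one_mul, S_trace]
  choose Q hQ using hS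
  refine ⟨(Matrix.of Q).det ^ 2, sq_nonneg _, fun v => ?_⟩
  rw [← det_S, ← Matrix.det_submatrix_equiv_self e]
  have : (Matrix.of fun i j => (S m i * Matrix.diagonal v * S m j).trace :
      Matrix (Idx m) (Idx m) ℝ).submatrix e e =
      Matrix.of Q * (Matrix.of fun i j => (B i * (U * Matrix.diagonal v * Uᵀ) * B j).trace :
        Matrix (Fin d) (Fin d) ℝ) * (Matrix.of Q)ᵀ := by
    ext k l
    have h1 : (S m (e k) * Matrix.diagonal v * S m (e l)).trace =
        ((U * S m (e k) * Uᵀ) * (U * Matrix.diagonal v * Uᵀ) * (U * S m (e l) * Uᵀ)).trace := by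
      have : (U * S m (e k) * Uᵀ) * (U * Matrix.diagonal v * Uᵀ) * (U * S m (e l) * Uᵀ) =
          U * (S m (e k) * (Uᵀ * U) * Matrix.diagonal v * (Uᵀ * U) * S m (e l) * Uᵀ) := by
        simp only [Matrix.mul_assoc]
      rw [this, Matrix.trace_mul_comm U, Matrix.mul_assoc _ Uᵀ U, hU]
      simp
    simp only [Matrix.submatrix_apply, Matrix.of_apply]
    rw [h1, ← hQ, ← hQ]
    simp only [Matrix.mul_apply (M := _ * _) (N := (Matrix.of Q)ᵀ), Finset.mul_sum,
      Matrix.trace_sum, Matrix.mul_smul, Matrix.trace_smul, smul_eq_mul, Matrix.sum_mul,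
      Matrix.smul_mul, Matrix.transpose_apply, Matrix.of_apply]
    apply Finset.sum_congr rfl
    intro j _
    rw [Matrix.mul_apply, mul_comm, Finset.mul_sum]
    rfl
  rw [this, Matrix.det_mul, Matrix.det_mul, Matrix.det_transpose]
  ring

lemma Ek_eq {m : ℕ} {X : Matrix (Fin (m + 1)) (Fin (m + 1)) ℝ}
    (v : Fin (m + 1) → ℝ) (U : Matrix (Fin (m + 1)) (Fin (m + 1)) ℝ) (hU : Uᵀ * U = 1)
    (hX : X = U * Matrix.diagonal v * Uᵀ) : Ek (m + 1) (m + 1 - 1) X = E1 v := by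
  have h1 : (-X).charpoly = ∏ i, (Polynomial.X + Polynomial.C (v i)) := by
    have : -X = U * (Matrix.diagonal (fun i => - v i) * Uᵀ) := by
      have h0 : Matrix.diagonal (fun i => - v i) = - Matrix.diagonal v :=
        (Matrix.diagonal_neg v).symm
      rw [hX, h0, Matrix.neg_mul, Matrix.mul_neg, Matrix.mul_assoc]
    rw [this, Matrix.charpoly_mul_comm, Matrix.mul_assoc, hU, Matrix.mul_one,
      Matrix.charpoly_diagonal]
    simp
  have h2 : m + 1 - (m + 1 - 1) = 1 := by omega
  have h3 := Polynomial.coeff_derivative (∏ i, (Polynomial.X + Polynomial.C (v i))) 0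
  rw [Ek, h2, h1]
  simp only [zero_add, Nat.cast_zero, mul_one] at h3
  rw [← h3, Polynomial.derivative_prod_finset, Polynomial.coeff_zero_eq_eval_zero, E1]
  simp [Polynomial.eval_finsetSum, Polynomial.eval_prod]

end Stmt5Aux

theorem stmt5 {n : ℕ} (hn : 2 ≤ n) (d : ℕ) (hd : d = n * (n + 1) / 2 - 1)
    (B : Fin d → Matrix (Fin n) (Fin n) ℝ)
    (hBsym : ∀ i, (B i).IsHermitian)
    (hBtr : ∀ i, (B i).trace = 0)
    (hBli : LinearIndependent ℝ B)
    (hBspan : ∀ A : Matrix (Fin n) (Fin n) ℝ, A.IsHermitian → A.trace = 0 →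
      A ∈ Submodule.span ℝ (Set.range B)) :
    ∃ c : ℝ, 0 < c ∧ ∀ (X : Matrix (Fin n) (Fin n) ℝ) (hX : X.IsHermitian),
      c * q hX * Ek n (n - 1) X =
        (Matrix.of fun i j => (B i * X * B j).trace : Matrix (Fin d) (Fin d) ℝ).det := by
  obtain ⟨m, rfl⟩ : ∃ m, n = m + 1 := ⟨n - 1, by omega⟩
  have hF : 0 < (∏ p ∈ Finset.univ.filter (fun p : Fin (m + 1) × Fin (m + 1) => p.1 < p.2),
        ((1 : ℝ) + 1)) * Stmt5Aux.E1 (fun _ : Fin (m + 1) => (1 : ℝ)) := by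
    apply mul_pos
    · exact Finset.prod_pos fun _ _ => by norm_num
    · simp only [Stmt5Aux.E1, Finset.prod_const_one]
      simp
      positivity
  set F := (∏ p ∈ Finset.univ.filter (fun p : Fin (m + 1) × Fin (m + 1) => p.1 < p.2),
        ((1 : ℝ) + 1)) * Stmt5Aux.E1 (fun _ : Fin (m + 1) => (1 : ℝ)) with hFdef
  set G := (Matrix.of fun i j => (B i * 1 * B j).trace : Matrix (Fin d) (Fin d) ℝ).det with hG
  have key : ∀ (U : Matrix (Fin (m + 1)) (Fin (m + 1)) ℝ) (hU : Uᵀ * U = 1),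
      ∃ r : ℝ, 0 < r ∧ r * G = F ∧ ∀ v : Fin (m + 1) → ℝ,
      r * (Matrix.of fun i j => (B i * (U * Matrix.diagonal v * Uᵀ) * B j).trace :
        Matrix (Fin d) (Fin d) ℝ).det =
      (∏ p ∈ Finset.univ.filter (fun p : Fin (m + 1) × Fin (m + 1) => p.1 < p.2),
        (v p.1 + v p.2)) * Stmt5Aux.E1 v := by
    intro U hU
    obtain ⟨r, hr, h⟩ := Stmt5Aux.main_id hd B hBspan U hU
    have h1 := h (fun _ => 1)
    rw [Matrix.diagonal_one, Matrix.mul_one, mul_eq_one_comm.mp hU, ← hG, ← hFdef] at h1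
    refine ⟨r, lt_of_le_of_ne hr ?_, h1, h⟩
    rintro rfl
    rw [zero_mul] at h1
    exact hF.ne h1
  have hGpos : 0 < G := by
    obtain ⟨r, hr, h, -⟩ := key 1 (by simp)
    exact pos_of_mul_pos_right (h ▸ hF) hr.le
  refine ⟨G / F, div_pos hGpos hF, fun X hX => ?_⟩
  obtain ⟨U, hU, hXU⟩ : ∃ U : Matrix (Fin (m + 1)) (Fin (m + 1)) ℝ, Uᵀ * U = 1 ∧
      X = U * Matrix.diagonal hX.eigenvalues * Uᵀ := by
    refine ⟨hX.eigenvectorUnitary, ?_, ?_⟩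
    · have := Unitary.coe_star_mul_self hX.eigenvectorUnitary
      rwa [Matrix.star_eq_conjTranspose, Matrix.conjTranspose_eq_transpose_of_trivial] at this
    · have := hX.spectral_theorem
      rw [Unitary.conjStarAlgAut_apply, Matrix.star_eq_conjTranspose,
        Matrix.conjTranspose_eq_transpose_of_trivial] at this
      exact this
  obtain ⟨r, hr, h1, h⟩ := key U hU
  have h2 := h hX.eigenvalues
  rw [← hXU] at h2
  rw [Stmt5Aux.Ek_eq _ U hU hXU, mul_assoc, q, ← h2, ← h1]
  field_simp
end

section
/- Let n ≥ 2 and let V_n be an n×(n−1) real matrix whose columns span the subspace 1_n^⊥ = {x ∈ ℝ^n : x_1 + ⋯ + x_n = 0}. Then there exists a positive real constant c such that c · e_{n−1}(x) = det(V_n^T diag(x) V_n) for all x ∈ ℝ^n, and consequently ℝ^{n,1} = {x ∈ ℝ^n : V_n^T diag(x) V_n is positive semidefinite}. -/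
open Matrix Finset

/-- The elementary symmetric polynomial of degree `k` in `n` variables. -/
def esymmVec (n k : ℕ) (x : Fin n → ℝ) : ℝ :=
  ∑ s ∈ Finset.powersetCard k Finset.univ, ∏ i ∈ s, x i

/-- The hyperplane `1ₙ^⊥ = {x ∈ ℝⁿ : x₁ + ⋯ + xₙ = 0}`. -/
def sumZero (n : ℕ) : Submodule ℝ (Fin n → ℝ) where
  carrier := {x | ∑ i, x i = 0}
  add_mem' := by
    intro a b ha hb
    simp only [Set.mem_setOf_eq, Pi.add_apply, Finset.sum_add_distrib] at *
    simp [ha, hb]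
  zero_mem' := by simp
  smul_mem' := by
    intro c x hx
    simp only [Set.mem_setOf_eq, Pi.smul_apply, smul_eq_mul, ← Finset.mul_sum] at *
    simp [hx]

lemma esymm_eq (m : ℕ) (x : Fin (m+1) → ℝ) :
    esymmVec (m+1) m x = ∑ i, ∏ j ∈ Finset.univ.erase i, x j := by
  unfold esymmVec
  symm
  refine Finset.sum_bij (fun i _ => Finset.univ.erase i) ?_ ?_ ?_ ?_
  · intro i _; simp [Finset.mem_powersetCard, Finset.card_erase_of_mem]
  · intro i _ j _ h
    by_contra hne
    have : j ∈ Finset.univ.erase i := by simp [Ne.symm hne]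
    rw [show Finset.univ.erase i = Finset.univ.erase j from h] at this; simp at this
  · intro s hs
    have hs := (Finset.mem_powersetCard.mp hs).2
    have : sᶜ.card = 1 := by rw [Finset.card_compl, hs]; simp
    obtain ⟨i, hi⟩ := Finset.card_eq_one.mp this
    refine ⟨i, Finset.mem_univ _, ?_⟩
    rw [← compl_compl s, hi]; ext; simp
  · intros; rfl

lemma det_ne (m : ℕ) (a : ℝ) (y : Fin m → ℝ) (hy : ∀ i, y i ≠ 0) :
    (Matrix.diagonal y + Matrix.of fun _ _ => a).det
      = ∏ i, y i + a * ∑ i, ∏ j ∈ Finset.univ.erase i, y j := by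
  have h := Matrix.det_add_replicateCol_mul_replicateRow (ι := Unit) (A := Matrix.diagonal y)
    (by rw [det_diagonal]; exact (Finset.prod_ne_zero_iff.mpr fun i _ => hy i).isUnit) (fun _ => a) (fun _ => 1)
  have e : (Matrix.of fun _ _ => a : Matrix (Fin m) (Fin m) ℝ) = replicateCol Unit (fun _ : Fin m => a) * replicateRow Unit (fun _ : Fin m => (1:ℝ)) := by
    ext i j; simp [Matrix.mul_apply]
  rw [e, h, det_diagonal]
  have hi : (Matrix.diagonal y)⁻¹ = Matrix.diagonal (fun i => (y i)⁻¹) := by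
    apply Matrix.inv_eq_left_inv
    rw [diagonal_mul_diagonal, ← diagonal_one]
    congr 1; ext i; simp [hy i]
  rw [hi, det_unique]
  simp only [Matrix.add_apply, Matrix.mul_apply, Matrix.one_apply, replicateRow_apply, replicateCol_apply, mul_diagonal]
  simp only [if_true, one_mul, mul_add, mul_one, ← Finset.sum_mul]
  congr 1
  rw [mul_comm _ a, ← mul_assoc, mul_comm _ a, mul_assoc, Finset.mul_sum]
  congr 1
  apply Finset.sum_congr rfl
  intro i _
  rw [← Finset.mul_prod_erase _ _ (Finset.mem_univ i)]
  simp only [Matrix.diagonal_apply, Finset.sum_ite_eq', Finset.mem_univ, if_true]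
  have := hy i
  field_simp

lemma det_all (m : ℕ) (a : ℝ) (y : Fin m → ℝ) :
    (Matrix.diagonal y + Matrix.of fun _ _ => a).det
      = ∏ i, y i + a * ∑ i, ∏ j ∈ Finset.univ.erase i, y j := by
  have hd : Dense {y : Fin m → ℝ | ∀ i, y i ≠ 0} := by
    have := dense_pi (s := fun _ : Fin m => ({0}ᶜ : Set ℝ)) Set.univ (fun i _ => dense_compl_singleton (0:ℝ))
    convert this using 1
    ext; simp
  have := Continuous.ext_on hd (f := fun y : Fin m → ℝ => (Matrix.diagonal y + Matrix.of fun _ _ => a).det)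
    (g := fun y => ∏ i, y i + a * ∑ i, ∏ j ∈ Finset.univ.erase i, y j)
    (by apply Continuous.matrix_det; fun_prop) (by fun_prop) (fun y hy => det_ne m a y hy)
  exact congrFun this y

lemma esymm_det (m : ℕ) (x : Fin (m+1) → ℝ) :
    (Matrix.diagonal (fun i : Fin m => x i.succ) + Matrix.of fun _ _ => x 0).det = esymmVec (m+1) m x := by
  rw [det_all, esymm_eq, Fin.sum_univ_succ]
  congr 1
  · have : (Finset.univ.erase (0 : Fin (m+1))) = Finset.univ.map (Fin.succEmb m) := by
      ext j; refine Fin.cases ?_ (fun k => ?_) j <;> simp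
    rw [this, Finset.prod_map]; rfl
  · rw [Finset.mul_sum]
    apply Finset.sum_congr rfl
    intro i _
    have : (Finset.univ.erase (i.succ : Fin (m+1))) = insert 0 ((Finset.univ.erase i).map (Fin.succEmb m)) := by
      ext j; refine Fin.cases ?_ (fun k => ?_) j
      · simp [(Fin.succ_ne_zero i).symm]
      · simp [Fin.succ_ne_zero]
    rw [this, Finset.prod_insert (by simp [Fin.succ_ne_zero]), Finset.prod_map]; rfl

lemma psd_iff (m : ℕ) (M G : Matrix (Fin m) (Fin m) ℝ) (hM : M.IsHermitian) (hG : G.PosDef) :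
    (∀ t : ℝ, (M - t • G).det = 0 → 0 ≤ t) ↔ M.PosSemidef := by
  constructor
  · intro h
    obtain ⟨S, hS⟩ : ∃ S : Matrix (Fin m) (Fin m) ℝ, G = Sᴴ * S := by
      open scoped MatrixOrder in
      exact (CStarAlgebra.nonneg_iff_eq_star_mul_self).mp hG.posSemidef.nonneg
    have hu : IsUnit S.det := by
      have := hG.det_pos.ne'
      rw [hS, det_mul] at this
      exact (right_ne_zero_of_mul this).isUnit
    set N := (S⁻¹)ᴴ * M * S⁻¹ with hN
    have hNH : N.IsHermitian := isHermitian_conjTranspose_mul_mul _ hM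
    have hMN : M = Sᴴ * N * S := by
      have h1 : Sᴴ * (S⁻¹)ᴴ = 1 := by rw [← conjTranspose_mul, nonsing_inv_mul _ hu]; simp
      calc M = (Sᴴ * (S⁻¹)ᴴ) * M * (S⁻¹ * S) := by rw [h1, nonsing_inv_mul _ hu]; simp
        _ = _ := by simp only [hN, Matrix.mul_assoc]
    have hP : N.PosSemidef := by
      rw [hNH.posSemidef_iff_eigenvalues_nonneg]
      intro i
      apply h
      have : M - hNH.eigenvalues i • G = Sᴴ * (N - hNH.eigenvalues i • 1) * S := by
        rw [hS, Matrix.mul_sub, Matrix.sub_mul, ← hMN]; simp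
      rw [this, det_mul, det_mul]
      have : (N - hNH.eigenvalues i • 1).det = 0 := by
        rw [← exists_mulVec_eq_zero_iff]
        refine ⟨(hNH.eigenvectorBasis i).ofLp, ?_, ?_⟩
        · intro h0
          have := hNH.eigenvectorBasis.orthonormal.ne_zero i
          exact this (by ext j; simpa using congrFun h0 j)
        · rw [sub_mulVec, hNH.mulVec_eigenvectorBasis, smul_mulVec, one_mulVec, sub_self]
      rw [this]; simp
    rw [hMN]
    exact hP.conjTranspose_mul_mul_same S
  · intro h t ht
    by_contra hlt
    push Not at hlt
    have : (M + (-t) • G).PosDef := PosDef.posSemidef_add h (hG.smul (by linarith))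
    have := this.det_pos
    rw [neg_smul, ← sub_eq_add_neg, ht] at this
    exact lt_irrefl _ this

theorem stmt6 {n : ℕ} (hn : 2 ≤ n)
    (V : Matrix (Fin n) (Fin (n - 1)) ℝ)
    (hV : Submodule.span ℝ (Set.range fun j : Fin (n - 1) => fun i => V i j) = sumZero n) :
    (∃ c : ℝ, 0 < c ∧ ∀ x : Fin n → ℝ,
        c * esymmVec n (n - 1) x = (Vᵀ * Matrix.diagonal x * V).det) ∧
      ∀ x : Fin n → ℝ,
        (∀ t : ℝ, esymmVec n (n - 1) (x - t • 1) = 0 → 0 ≤ t) ↔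
          (Vᵀ * Matrix.diagonal x * V).PosSemidef := by
  obtain ⟨m, rfl⟩ : ∃ m, n = m + 1 := ⟨n - 1, by omega⟩
  change Matrix (Fin (m+1)) (Fin m) ℝ at V
  change Submodule.span ℝ (Set.range fun j : Fin m => fun i => V i j) = sumZero (m+1) at hV
  change (∃ c : ℝ, 0 < c ∧ ∀ x : Fin (m+1) → ℝ,
        c * esymmVec (m+1) m x = (Vᵀ * Matrix.diagonal x * V).det) ∧
      ∀ x : Fin (m+1) → ℝ,
        (∀ t : ℝ, esymmVec (m+1) m (x - t • 1) = 0 → 0 ≤ t) ↔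
          (Vᵀ * Matrix.diagonal x * V).PosSemidef
  set B : Matrix (Fin m) (Fin m) ℝ := V.submatrix Fin.succ id with hB
  have h0 : ∀ j, V 0 j = - ∑ i, B i j := by
    intro j
    have : (fun i => V i j) ∈ sumZero (m+1) := hV ▸ Submodule.subset_span ⟨j, rfl⟩
    have : ∑ i, V i j = 0 := this
    rw [Fin.sum_univ_succ] at this
    simp only [hB, submatrix_apply, id]
    linarith
  have hBu : IsUnit B := by
    rw [← mulVec_surjective_iff_isUnit]
    intro y
    have : (Fin.cons (-∑ i, y i) y : Fin (m+1) → ℝ) ∈ sumZero (m+1) := by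
      change ∑ i, _ = (0:ℝ)
      rw [Fin.sum_univ_succ]; simp
    rw [← hV, Submodule.mem_span_range_iff_exists_fun] at this
    obtain ⟨c, hc⟩ := this
    refine ⟨c, ?_⟩
    ext i
    have := congrFun hc i.succ
    simp only [Finset.sum_apply, Pi.smul_apply, smul_eq_mul, Fin.cons_succ] at this
    rw [← this]
    simp [mulVec, dotProduct, hB, mul_comm]
  have hBd : B.det ≠ 0 := ((isUnit_iff_isUnit_det _).mp hBu).ne_zero
  have key : ∀ x : Fin (m+1) → ℝ, Vᵀ * Matrix.diagonal x * V
      = Bᵀ * (Matrix.diagonal (fun i : Fin m => x i.succ) + Matrix.of fun _ _ => x 0) * B := by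
    intro x
    ext j k
    rw [Matrix.mul_add, Matrix.add_mul, Matrix.add_apply, Matrix.mul_apply, Fin.sum_univ_succ, add_comm]
    congr 1
    · rw [Matrix.mul_apply]
      simp [hB, mul_diagonal]
    · rw [mul_diagonal]
      simp only [transpose_apply, h0, Matrix.mul_apply, of_apply, ← Finset.sum_mul, ← Finset.mul_sum]
      ring
  have hdet : ∀ x : Fin (m+1) → ℝ,
        B.det ^ 2 * esymmVec (m+1) m x = (Vᵀ * Matrix.diagonal x * V).det := by
    intro x
    rw [key, det_mul, det_mul, esymm_det, det_transpose]; ring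
  have hc : 0 < B.det ^ 2 := by positivity
  refine ⟨⟨_, hc, hdet⟩, fun x => ?_⟩
  have hG : (Vᵀ * V).PosDef := by
    have : Function.Injective V.mulVec := by
      intro u v huv
      apply mulVec_injective_of_isUnit hBu
      ext i
      exact congrFun huv i.succ
    simpa using PosDef.conjTranspose_mul_self V this
  rw [← psd_iff m _ _ _ hG]
  · refine forall_congr' fun t => ?_
    have : Vᵀ * Matrix.diagonal x * V - t • (Vᵀ * V) = Vᵀ * Matrix.diagonal (x - t • 1) * V := by
      have : Matrix.diagonal (x - t • 1) = Matrix.diagonal x - t • (1 : Matrix (Fin (m+1)) (Fin (m+1)) ℝ) := by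
        ext i j; by_cases h : i = j <;> simp [h, Matrix.diagonal_apply, Matrix.one_apply]
      rw [this, Matrix.mul_sub, Matrix.sub_mul]; simp
    rw [this, ← hdet, mul_eq_zero, or_iff_right hc.ne']
  · have := isHermitian_conjTranspose_mul_mul V (isHermitian_diagonal x)
    simpa using this
end

section
/- Let n ≥ 2. Then ℝ^{n,1} = {x ∈ ℝ^n : Σ_{i=1}^n x_i y_i^2 ≥ 0 for every y ∈ ℝ^n with y_1 + ⋯ + y_n = 0}; that is, x belongs to the hyperbolicity cone of e_{n−1} with respect to 1_n if and only if y^T diag(x) y ≥ 0 for all y orthogonal to the all-ones vector. -/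
open Matrix Finset

theorem aux_esymm {n : ℕ} (hn : 2 ≤ n) (z : Fin n → ℝ) :
    esymmVec n (n - 1) z = ∑ i, ∏ j ∈ univ.erase i, z j := by
  unfold esymmVec
  symm
  refine Finset.sum_bij (fun i _ => univ.erase i) ?_ ?_ ?_ ?_
  · intro i _
    simp [Finset.mem_powersetCard]
  · intro a _ b _ h
    by_contra hab
    have h1 : a ∈ (univ : Finset (Fin n)).erase b := by simp [hab]
    have h2 : a ∈ (univ : Finset (Fin n)).erase a := by
      have h' : (univ : Finset (Fin n)).erase a = univ.erase b := h
      rw [h']; exact h1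
    simp at h2
  · intro s hs
    have hc : s.card = n - 1 := (Finset.mem_powersetCard.1 hs).2
    have h1 : sᶜ.card = 1 := by
      rw [Finset.card_compl, hc, Fintype.card_fin]; omega
    obtain ⟨a, ha⟩ := Finset.card_eq_one.1 h1
    refine ⟨a, mem_univ _, ?_⟩
    have : s = {a}ᶜ := by rw [← ha, compl_compl]
    rw [this]
    ext j
    simp
  · intro i _
    rfl

theorem aux_split {n : ℕ} (z : Fin n → ℝ) (k : Fin n) (hz : ∀ j, j ≠ k → z j ≠ 0) :
    ∑ i, ∏ j ∈ univ.erase i, z j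
      = (∏ j ∈ univ.erase k, z j) * (1 + z k * ∑ j ∈ univ.erase k, (z j)⁻¹) := by
  rw [← Finset.add_sum_erase _ _ (mem_univ k), mul_add, mul_one, Finset.mul_sum, Finset.mul_sum]
  congr 1
  refine Finset.sum_congr rfl fun i hi => ?_
  have hik : i ≠ k := Finset.ne_of_mem_erase hi
  have e1 : z i * ∏ j ∈ univ.erase i, z j = ∏ j, z j := Finset.mul_prod_erase _ _ (mem_univ i)
  have e2 : z k * ∏ j ∈ univ.erase k, z j = ∏ j, z j := Finset.mul_prod_erase _ _ (mem_univ k)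
  have h0 := hz i hik
  have : (∏ j ∈ univ.erase k, z j) * (z k * (z i)⁻¹)
      = (z k * ∏ j ∈ univ.erase k, z j) * (z i)⁻¹ := by ring
  rw [this, e2, ← e1]
  field_simp

theorem aux_form {n : ℕ} (z : Fin n → ℝ) (k : Fin n) (hz : ∀ j, j ≠ k → 0 < z j)
    (hE : 0 < ∑ i, ∏ j ∈ univ.erase i, z j) (y : Fin n → ℝ) (hy : ∑ i, y i = 0) :
    0 ≤ ∑ i, z i * y i ^ 2 := by
  rw [aux_split z k fun j hj => (hz j hj).ne'] at hE
  have hP : 0 < ∏ j ∈ univ.erase k, z j :=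
    Finset.prod_pos fun j hj => hz j (Finset.ne_of_mem_erase hj)
  have hS := (mul_pos_iff_of_pos_left hP).1 hE
  rw [← Finset.add_sum_erase _ _ (mem_univ k)] at hy ⊢
  have hF : 0 ≤ ∑ j ∈ univ.erase k, z j * y j ^ 2 :=
    Finset.sum_nonneg fun j hj => by
      have := hz j (Finset.ne_of_mem_erase hj)
      positivity
  rcases le_or_gt 0 (z k) with h | h
  · positivity
  have hcs : (∑ j ∈ univ.erase k, y j) ^ 2
      ≤ (∑ j ∈ univ.erase k, (z j)⁻¹) * ∑ j ∈ univ.erase k, z j * y j ^ 2 := by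
    refine Finset.sum_sq_le_sum_mul_sum_of_sq_eq_mul _ ?_ ?_ ?_
    · intro j hj
      exact (inv_pos.2 (hz j (Finset.ne_of_mem_erase hj))).le
    · intro j hj
      have := hz j (Finset.ne_of_mem_erase hj)
      positivity
    · intro j hj
      have := hz j (Finset.ne_of_mem_erase hj)
      field_simp
  have hyk : y k ^ 2 = (∑ j ∈ univ.erase k, y j) ^ 2 := by
    have : y k = -∑ j ∈ univ.erase k, y j := by linarith
    rw [this]; ring
  rw [← hyk] at hcs
  nlinarith [mul_le_mul_of_nonneg_left hcs (neg_pos.2 h).le, mul_nonneg hS.le hF]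

theorem stmt7 {n : ℕ} (hn : 2 ≤ n) (x : Fin n → ℝ) :
    (∀ t : ℝ, esymmVec n (n - 1) (x - t • 1) = 0 → 0 ≤ t) ↔
      ∀ y : Fin n → ℝ, ∑ i, y i = 0 → 0 ≤ ∑ i, x i * y i ^ 2 := by
  haveI : Nonempty (Fin n) := ⟨⟨0, by omega⟩⟩
  constructor
  · intro H
    let E : ℝ → ℝ := fun s => ∑ i, ∏ j ∈ univ.erase i, (x j + s)
    have hEc : Continuous E := by fun_prop
    have hne : ∀ s, 0 < s → E s ≠ 0 := by
      intro s hs h0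
      have := H (-s) (by
        rw [aux_esymm hn]
        simpa [E] using h0)
      linarith
    obtain ⟨k, hk⟩ := Finite.exists_min x
    have hpos : ∀ s, 0 < s → 0 < E s := by
      intro s hs
      by_contra hc
      push Not at hc
      let M := s + |x k| + 1
      have hM : 0 ≤ E M := by
        refine Finset.sum_nonneg fun i _ => Finset.prod_nonneg fun j _ => ?_
        have := hk j
        have := neg_abs_le (x k)
        simp only [M]; linarith
      have hsM : s ≤ M := by
        have := abs_nonneg (x k)
        simp only [M]; linarith
      obtain ⟨c, hc1, hc2⟩ := intermediate_value_Icc hsM hEc.continuousOn ⟨hc, hM⟩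
      exact hne c (by linarith [hc1.1]) hc2
    have hoth : ∀ j, j ≠ k → 0 ≤ x j := by
      have hnon : (univ.erase k).Nonempty := by
        rw [← Finset.card_pos]; simp; omega
      obtain ⟨m, hm, hmin⟩ := Finset.exists_min_image (univ.erase k) x hnon
      have hmk : m ≠ k := Finset.ne_of_mem_erase hm
      intro j hj
      refine le_trans ?_ (hmin j (by simp [hj]))
      by_contra hneg
      push Not at hneg
      have h1 := hpos (-x m) (by linarith)
      have h2 : E (-x m) = ∏ i ∈ univ.erase m, (x i + -x m) := by
        refine Finset.sum_eq_single m ?_ ?_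
        · intro b _ hb
          exact Finset.prod_eq_zero (i := m) (by simp [hb.symm]) (by ring)
        · simp
      have hkm : k ∈ (univ : Finset (Fin n)).erase m := by simp [hmk.symm]
      rw [h2, ← Finset.mul_prod_erase _ _ hkm] at h1
      have h3 : 0 ≤ ∏ i ∈ (univ.erase m).erase k, (x i + -x m) := by
        refine Finset.prod_nonneg fun i hi => ?_
        have := hmin i (by simp [Finset.ne_of_mem_erase hi])
        linarith
      nlinarith [hk m]
    intro y hy
    have key : ∀ s, 0 < s → 0 ≤ (∑ i, x i * y i ^ 2) + s * ∑ i, y i ^ 2 := by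
      intro s hs
      have := aux_form (fun i => x i + s) k
        (fun j hj => by have := hoth j hj; linarith) (hpos s hs) y hy
      simpa [add_mul, Finset.sum_add_distrib, Finset.mul_sum] using this
    by_contra hneg
    push Not at hneg
    have hQ : 0 ≤ ∑ i, y i ^ 2 := Finset.sum_nonneg fun i _ => sq_nonneg _
    set A := ∑ i, x i * y i ^ 2
    set Q := ∑ i, y i ^ 2
    have hs : 0 < -A / (Q + 1) / 1 := by
      have : 0 < -A := by linarith
      positivity
    have := key _ hs
    have h5 : A + -A / (Q + 1) / 1 * Q = A / (Q + 1) := by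
      field_simp; ring
    rw [h5] at this
    have h6 : A / (Q + 1) < 0 := div_neg_of_neg_of_pos hneg (by linarith)
    linarith
  · intro H t ht
    rw [aux_esymm hn] at ht
    by_contra hneg
    push Not at hneg
    set z : Fin n → ℝ := x - t • 1 with hzdef
    have hzx : ∀ i, x i = z i + t := by intro i; simp [hzdef]
    have main : ∀ y : Fin n → ℝ, ∑ i, y i = 0 → ∑ i, z i * y i ^ 2 = 0 → ∀ i, y i = 0 := by
      intro y hy hzy i
      have h1 := H y hy
      have h2 : ∑ i, x i * y i ^ 2 = ∑ i, z i * y i ^ 2 + t * ∑ i, y i ^ 2 := by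
        rw [Finset.mul_sum, ← Finset.sum_add_distrib]
        exact Finset.sum_congr rfl fun i _ => by rw [hzx]; ring
      rw [h2, hzy] at h1
      have h3 : y i ^ 2 ≤ ∑ i, y i ^ 2 :=
        Finset.single_le_sum (f := fun i => y i ^ 2) (fun i _ => sq_nonneg _) (mem_univ i)
      have h4 : y i ^ 2 ≤ 0 := by nlinarith
      exact pow_eq_zero_iff (two_ne_zero) |>.1 (le_antisymm h4 (sq_nonneg _))
    by_cases hz : ∀ i, z i ≠ 0
    · obtain ⟨k⟩ := ‹Nonempty (Fin n)›
      rw [aux_split z k fun j _ => hz j] at ht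
      have hP : ∏ j ∈ univ.erase k, z j ≠ 0 := Finset.prod_ne_zero_iff.2 fun j _ => hz j
      have hS := (mul_eq_zero.1 ht).resolve_left hP
      have hsum : ∑ i, (z i)⁻¹ = 0 := by
        rw [← Finset.add_sum_erase _ _ (mem_univ k)]
        have := hz k
        have h7 : (z k)⁻¹ + ∑ j ∈ univ.erase k, (z j)⁻¹
            = (z k)⁻¹ * (1 + z k * ∑ j ∈ univ.erase k, (z j)⁻¹) := by
          rw [mul_add, inv_mul_cancel_left₀ this, mul_one]
        rw [h7, hS, mul_zero]
      have := main (fun i => (z i)⁻¹) hsum (by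
        rw [← hsum]
        exact Finset.sum_congr rfl fun i _ => by have := hz i; field_simp) k
      exact inv_ne_zero (hz k) this
    · push Not at hz
      obtain ⟨a, ha⟩ := hz
      have h2 : ∑ i, ∏ j ∈ univ.erase i, z j = ∏ i ∈ univ.erase a, z i := by
        refine Finset.sum_eq_single a ?_ ?_
        · intro b _ hb
          exact Finset.prod_eq_zero (i := a) (by simp [hb.symm]) ha
        · simp
      rw [h2, Finset.prod_eq_zero_iff] at ht
      obtain ⟨b, hb, hzb⟩ := ht
      have hba : b ≠ a := Finset.ne_of_mem_erase hb
      have := main (fun i => (if i = a then 1 else 0) - (if i = b then 1 else 0))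
        (by simp) (by
          refine Finset.sum_eq_zero fun i _ => ?_
          by_cases h1 : i = a
          · rw [h1, ha, zero_mul]
          · by_cases h2 : i = b
            · rw [h2, hzb, zero_mul]
            · simp [h1, h2]) a
      simp [hba.symm] at this
end

section
/- Let K_1 and K_2 be subsets of the space of n×n real symmetric matrices such that Q K_1 Q^T = K_1 and Q K_2 Q^T = K_2 for every n×n real orthogonal matrix Q. If {x ∈ ℝ^n : diag(x) ∈ K_1} = {x ∈ ℝ^n : diag(x) ∈ K_2}, then K_1 = K_2. -/
open Matrix

theorem stmt8_diag {n : ℕ} (A : Matrix (Fin n) (Fin n) ℝ) (hA : A.IsHermitian) :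
    ∃ (Q : Matrix (Fin n) (Fin n) ℝ) (x : Fin n → ℝ), Qᵀ * Q = 1 ∧ A = Q * diagonal x * Qᵀ := by
  refine ⟨hA.eigenvectorUnitary, hA.eigenvalues, ?_, ?_⟩
  · have := Unitary.coe_star_mul_self hA.eigenvectorUnitary
    rwa [star_eq_conjTranspose, conjTranspose_eq_transpose_of_trivial] at this
  · have := hA.spectral_theorem
    rw [Unitary.conjStarAlgAut_apply, star_eq_conjTranspose,
      conjTranspose_eq_transpose_of_trivial] at this
    exact this

theorem stmt8_sub {n : ℕ} (K₁ K₂ : Set (Matrix (Fin n) (Fin n) ℝ))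
    (hK₁sym : ∀ X ∈ K₁, X.IsHermitian)
    (hK₁ : ∀ Q : Matrix (Fin n) (Fin n) ℝ, Qᵀ * Q = 1 → (fun X => Q * X * Qᵀ) '' K₁ = K₁)
    (hK₂ : ∀ Q : Matrix (Fin n) (Fin n) ℝ, Qᵀ * Q = 1 → (fun X => Q * X * Qᵀ) '' K₂ = K₂)
    (h : {x : Fin n → ℝ | Matrix.diagonal x ∈ K₁} = {x : Fin n → ℝ | Matrix.diagonal x ∈ K₂}) :
    K₁ ⊆ K₂ := by
  intro A hA
  obtain ⟨Q, x, hQ, rfl⟩ := stmt8_diag A (hK₁sym A hA)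
  have h1 : diagonal x ∈ K₁ := by
    rw [← hK₁ Q hQ] at hA
    obtain ⟨Y, hY, hYe⟩ := hA
    have e : Y = diagonal x := by
      have := congrArg (fun Z => Qᵀ * Z * Q) hYe
      simp only [Matrix.mul_assoc, hQ, Matrix.mul_one] at this
      simpa only [← Matrix.mul_assoc, hQ, Matrix.one_mul] using this
    exact e ▸ hY
  have h2 : x ∈ {x : Fin n → ℝ | Matrix.diagonal x ∈ K₂} := h ▸ h1
  rw [← hK₂ Q hQ]
  exact ⟨_, h2, rfl⟩

theorem stmt8 {n : ℕ} (K₁ K₂ : Set (Matrix (Fin n) (Fin n) ℝ))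
    (hK₁sym : ∀ X ∈ K₁, X.IsHermitian) (hK₂sym : ∀ X ∈ K₂, X.IsHermitian)
    (hK₁ : ∀ Q : Matrix (Fin n) (Fin n) ℝ, Qᵀ * Q = 1 → (fun X => Q * X * Qᵀ) '' K₁ = K₁)
    (hK₂ : ∀ Q : Matrix (Fin n) (Fin n) ℝ, Qᵀ * Q = 1 → (fun X => Q * X * Qᵀ) '' K₂ = K₂)
    (h : {x : Fin n → ℝ | Matrix.diagonal x ∈ K₁} = {x : Fin n → ℝ | Matrix.diagonal x ∈ K₂}) :
    K₁ = K₂ := by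
  exact Set.Subset.antisymm (stmt8_sub K₁ K₂ hK₁sym hK₁ hK₂ h)
    (stmt8_sub K₂ K₁ hK₂sym hK₂ hK₁ h.symm)
end

section
/- Let n ≥ 2. A real symmetric n×n matrix X belongs to S^{n,n−2} if and only if tr(X) ≥ 0 and (tr X)^2 − tr(X^2) ≥ 0. -/
open Matrix Finset

theorem aux_esymm_s14 {n : ℕ} (f : Fin n → ℝ) :
    2 * ((univ : Finset (Fin n)).val.map f).esymm 2 = (∑ i, f i) ^ 2 - ∑ i, f i ^ 2 := by
  have h := congrArg (MvPolynomial.aeval f) (MvPolynomial.mul_esymm_eq_sum (Fin n) ℝ 2)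
  have hs : ({a ∈ antidiagonal 2 | a.1 < 2} : Finset (ℕ × ℕ)) = {(0, 2), (1, 1)} := by decide
  rw [hs, Finset.sum_pair (by decide)] at h
  simp only [map_mul, map_add, MvPolynomial.aeval_esymm_eq_multiset_esymm] at h
  have e0 : ((univ : Finset (Fin n)).val.map f).esymm 0 = 1 := by simp [Multiset.esymm]
  have e1 : ((univ : Finset (Fin n)).val.map f).esymm 1 = ∑ i, f i := by
    rw [← MvPolynomial.aeval_esymm_eq_multiset_esymm (Fin n) ℝ, MvPolynomial.esymm_one]
    simp
  rw [e0, e1] at h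
  simp only [MvPolynomial.psum, map_sum, map_pow, MvPolynomial.aeval_X, map_neg, map_one,
    map_ofNat, Nat.cast_ofNat, pow_one] at h
  rw [h]
  ring

theorem aux_trace_sq {n : ℕ} (A : Matrix (Fin n) (Fin n) ℝ) (hA : A.IsHermitian) :
    (A ^ 2).trace = ∑ i, hA.eigenvalues i ^ 2 := by
  conv_lhs => rw [hA.spectral_theorem, ← map_pow, Unitary.conjStarAlgAut_apply, trace_mul_comm,
    ← mul_assoc]
  simp [diagonal_pow, trace_diagonal]

theorem aux_Ek {n : ℕ} (hn : 2 ≤ n) (A : Matrix (Fin n) (Fin n) ℝ) (hA : A.IsHermitian) :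
    2 * Ek n 2 A = A.trace ^ 2 - (A ^ 2).trace := by
  have hB : (-A).IsHermitian := hA.neg
  have h1 : (-A).trace ^ 2 - ((-A) ^ 2).trace = A.trace ^ 2 - (A ^ 2).trace := by
    simp [trace_neg]
  have h3 := aux_esymm_s14 hB.eigenvalues
  have h2 := Multiset.prod_X_sub_C_coeff
    ((univ : Finset (Fin n)).val.map hB.eigenvalues) (k := n - 2) (by simp)
  have h4 : n - (n - 2) = 2 := by omega
  simp only [Multiset.card_map, Finset.card_val, Finset.card_univ, Fintype.card_fin, h4,
    Multiset.map_map] at h2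
  rw [← h1, aux_trace_sq _ hB, hB.trace_eq_sum_eigenvalues, Ek, hB.charpoly_eq]
  simp only [RCLike.ofReal_real_eq_id, id]
  rw [← h3]
  simpa [Finset.prod] using h2

theorem stmt14 {n : ℕ} (hn : 2 ≤ n) (X : Matrix (Fin n) (Fin n) ℝ) (hX : X.IsHermitian) :
    (∀ t : ℝ, Ek n 2 (X - t • 1) = 0 → 0 ≤ t) ↔
      0 ≤ X.trace ∧ 0 ≤ X.trace ^ 2 - (X ^ 2).trace := by
  have hn' : (2 : ℝ) ≤ n := by exact_mod_cast hn
  have key : ∀ t : ℝ, 2 * Ek n 2 (X - t • 1) =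
      n * (n - 1) * t ^ 2 - 2 * (n - 1) * X.trace * t + (X.trace ^ 2 - (X ^ 2).trace) := by
    intro t
    have hH : (X - t • (1 : Matrix (Fin n) (Fin n) ℝ)).IsHermitian := by
      refine hX.sub ?_
      simp [Matrix.IsHermitian]
    rw [aux_Ek hn _ hH]
    have : (X - t • (1 : Matrix (Fin n) (Fin n) ℝ)) ^ 2 = X ^ 2 - (2 * t) • X + (t ^ 2) • 1 := by
      simp only [pow_two, sub_mul, mul_sub, smul_mul_assoc, mul_smul_comm, mul_one, one_mul]
      module
    rw [this]
    simp only [trace_sub, trace_add, trace_smul, trace_one, Fintype.card_fin, smul_eq_mul]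
    ring
  have cs : X.trace ^ 2 ≤ n * (X ^ 2).trace := by
    rw [aux_trace_sq _ hX, hX.trace_eq_sum_eigenvalues]
    simpa using sq_sum_le_card_mul_sum_sq (s := univ) (f := hX.eigenvalues)
  generalize X.trace = T at *
  generalize (X ^ 2).trace = Q at *
  constructor
  · intro h
    have hD : 0 ≤ (n * Q - T ^ 2) / (n - 1 : ℝ) := div_nonneg (by linarith) (by linarith)
    have hs := Real.sq_sqrt hD
    have hs0 := Real.sqrt_nonneg ((n * Q - T ^ 2) / (n - 1 : ℝ))
    set s := √((n * Q - T ^ 2) / (n - 1 : ℝ))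
    have hne : (n - 1 : ℝ) ≠ 0 := by linarith
    have hs' : s ^ 2 * (n - 1) = n * Q - T ^ 2 := by rw [hs]; field_simp
    have ht := h ((T - s) / n) (by
      have hk := key ((T - s) / n)
      have h0 : (n : ℝ) * (n - 1) * ((T - s) / n) ^ 2 - 2 * (n - 1) * T * ((T - s) / n)
          + (T ^ 2 - Q) = (s ^ 2 * (n - 1) - (n * Q - T ^ 2)) / n := by
        field_simp
        ring
      rw [h0, hs', sub_self, zero_div] at hk
      linarith)
    have hts : 0 ≤ T - s := by
      have := mul_nonneg ht (by linarith : (0 : ℝ) ≤ n)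
      rwa [div_mul_cancel₀ _ (by linarith)] at this
    refine ⟨by linarith, ?_⟩
    have h1 : s ^ 2 ≤ T ^ 2 := pow_le_pow_left₀ hs0 (by linarith) 2
    have h2 : 0 ≤ (n : ℝ) * (T ^ 2 - Q) := by nlinarith
    exact nonneg_of_mul_nonneg_right h2 (by linarith)
  · rintro ⟨hT, hQ⟩ t ht
    by_contra! hlt
    have hk := key t
    rw [ht] at hk
    have h1 : 0 < (n : ℝ) * (n - 1) * t ^ 2 :=
      mul_pos (mul_pos (by linarith) (by linarith)) (by nlinarith)
    have h2 : 0 ≤ 2 * ((n : ℝ) - 1) * T * (-t) :=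
      mul_nonneg (mul_nonneg (by linarith) hT) (by linarith)
    linarith
end
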